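/- Let S be a symmetric reflexive relation on the set R of rays of T'_m. Then the events K̄^S_{e,Λ} decrease to K^S_e as Λ↑V — that is, K^S_e = ⋂_Λ K̄^S_{e,Λ}, the intersection over all boxes Λ — for every edge e∈E, if and only if S is a closed subset of R×R. -/

import Mathlib

open MeasureTheory

namespace RCTree

abbrev Edge (m : ℕ) := Fin (m + 1) × List (Fin m)
abbrev V (m : ℕ) := Option (Edge m)
abbrev Ray (m : ℕ) := Fin (m + 1) × (ℕ → Fin m)
abbrev Config (m : ℕ) := Edge m → Bool

variable {m : ℕ}

/-- The vertex at the top (towards the root) of an edge. -/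
def parentV (e : Edge m) : V m :=
  if e.2 = [] then none else some (e.1, e.2.dropLast)

/-- The vertex at the bottom (away from the root) of an edge. -/
def childV (e : Edge m) : V m := some e

/-- The (undirected) edge `e` has endvertices `u` and `v`. -/
def EndsAt (e : Edge m) (u v : V m) : Prop :=
  (parentV e = u ∧ childV e = v) ∨ (parentV e = v ∧ childV e = u)

/-- The `n`-th edge of a ray from the root. -/
def rayEdge (ρ : Ray m) (n : ℕ) : Edge m := (ρ.1, List.ofFn fun k : Fin n => ρ.2 k)

/-- The `n`-th vertex of a ray from the root. -/
def rayVtx (ρ : Ray m) : ℕ → V m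
  | 0 => none
  | n + 1 => some (rayEdge ρ n)

def rayEdges (ρ : Ray m) : Set (Edge m) := Set.range (rayEdge ρ)

/-- The ray `ρ` passes through the vertex `v`. -/
def RayThrough (ρ : Ray m) (v : V m) : Prop := ∃ n, rayVtx ρ n = v

/-- All edges of the ray `ρ` are open in `ω`. -/
def OpenRay (ω : Config m) (ρ : Ray m) : Prop := ∀ n, ω (rayEdge ρ n) = true

/-- An infinite self-avoiding (undirected) path with endpoint `x`. -/
structure IPath (m : ℕ) (x : V m) where
  vtx : ℕ → V m
  start : vtx 0 = x
  inj : Function.Injective vtx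
  adj : ∀ n, ∃ e : Edge m, EndsAt e (vtx n) (vtx (n + 1))

/-- The edges traversed by an infinite path. -/
def IPath.edges {x : V m} (π : IPath m x) : Set (Edge m) :=
  {e | ∃ n, EndsAt e (π.vtx n) (π.vtx (n + 1))}

/-- A path is forward (an `x`-ray) if it is directed away from the root. -/
def IPath.Forward {x : V m} (π : IPath m x) : Prop :=
  ∀ n, ∃ e : Edge m, parentV e = π.vtx n ∧ childV e = π.vtx (n + 1)

/-- All edges of the path `π` are open in `ω`. -/
def OpenPath {x : V m} (ω : Config m) (π : IPath m x) : Prop :=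
  ∀ e ∈ π.edges, ω e = true

/-- The path `π` and the `0`-ray `ρ` differ in only finitely many edges:
`ρ` is the `0`-ray associated with `π`. -/
def Assoc {x : V m} (π : IPath m x) (ρ : Ray m) : Prop :=
  ((IPath.edges π \ rayEdges ρ) ∪ (rayEdges ρ \ IPath.edges π)).Finite

/-- The set of edges with both endvertices in `Λ`. -/
def ELam (Λ : Set (V m)) : Set (Edge m) :=
  {e | parentV e ∈ Λ ∧ childV e ∈ Λ}

/-- The event `K^S_{u,v,Λ}`: there exist vertex-disjoint open infinite paths from `u` and
from `v`, edge-disjoint from `E_Λ`, whose associated `0`-rays are `S`-related. -/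
def KEvent (S : Ray m → Ray m → Prop) (Λ : Set (V m)) (u v : V m) : Set (Config m) :=
  {ω | ∃ (πu : IPath m u) (πv : IPath m v),
      (∀ a b, πu.vtx a ≠ πv.vtx b) ∧
      OpenPath ω πu ∧ OpenPath ω πv ∧
      (∀ e ∈ πu.edges, e ∉ ELam Λ) ∧ (∀ e ∈ πv.edges, e ∉ ELam Λ) ∧
      ∃ ρu ρv : Ray m, Assoc πu ρu ∧ Assoc πv ρv ∧ S ρu ρv}

/-- The event `A^S_{u,v}`: there exist open `u`- and `v`-rays whose associated
`0`-rays are `S`-related. -/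
def AEvent (S : Ray m → Ray m → Prop) (u v : V m) : Set (Config m) :=
  {ω | ∃ (πu : IPath m u) (πv : IPath m v),
      πu.Forward ∧ πv.Forward ∧ OpenPath ω πu ∧ OpenPath ω πv ∧
      ∃ ρu ρv : Ray m, Assoc πu ρu ∧ Assoc πv ρv ∧ S ρu ρv}

/-- The event `A'^S_{u,v}`: there exist open `0`-rays through `u` and through `v`
that are `S`-related. -/
def APrimeEvent (S : Ray m → Ray m → Prop) (u v : V m) : Set (Config m) :=
  {ω | ∃ ρu ρv : Ray m, RayThrough ρu u ∧ RayThrough ρv v ∧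
      OpenRay ω ρu ∧ OpenRay ω ρv ∧ S ρu ρv}

/-- `u` lies on the (unique) path of the tree from the root to `v` (ancestor-or-equal). -/
def Anc : V m → V m → Prop
  | none, _ => True
  | some _, none => False
  | some e, some f => e.1 = f.1 ∧ e.2 <+: f.2

/-- Two vertices are comparable if one lies on the path from the root to the other. -/
def Comparable (u v : V m) : Prop := Anc u v ∨ Anc v u

/-- `W` is a cutset: it is incomparable (no ray contains more than one member of `W`)
and every ray contains some member of `W`. -/
def IsCutset (W : Set (V m)) : Prop :=
  (∀ (ρ : Ray m) (u v : V m), u ∈ W → v ∈ W → RayThrough ρ u → RayThrough ρ v → u = v) ∧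
  ∀ ρ : Ray m, ∃ v ∈ W, RayThrough ρ v


open Classical in
/-- `ω¹_Λ`: the configuration agreeing with `ω` on `E_Λ` and equal to `1` (open) elsewhere. -/
noncomputable def patchOne (Λ : Set (V m)) (ω : Config m) : Config m :=
  fun e => if e ∈ ELam Λ then ω e else true

/-- The interior of a cutset `W`: vertices reachable from the root by a path
vertex-disjoint from `W` (equivalently, having no ancestor-or-self in `W`). -/
def insC (W : Set (V m)) : Set (V m) := {v | ∀ u, Anc u v → u ∉ W}

/-- A box of the tree: `W ∪ ins(W)` for some cutset `W`. -/
def IsBox (Λ : Set (V m)) : Prop := ∃ W : Set (V m), IsCutset W ∧ Λ = W ∪ insC W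

/-- The event `K^S_e` for an edge `e = ⟨u,v⟩`. -/
def KEdge (S : Ray m → Ray m → Prop) (e : Edge m) : Set (Config m) :=
  KEvent S {parentV e, childV e} (parentV e) (childV e)

/-- The cylinder event `K̄^S_{e,Λ} = {ω : ω¹_Λ ∈ K^S_e}`. -/
noncomputable def KBar (S : Ray m → Ray m → Prop) (e : Edge m) (Λ : Set (V m)) :
    Set (Config m) :=
  {ω | patchOne Λ ω ∈ KEdge S e}

/-- The edges on the path from the root to a vertex. -/
def rootEdges (x : V m) : Set (Edge m) := {f | Anc (some f) x}

/-- The edges of the path from `x` which ends along the ray `ρ`. -/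
def pathEdges (x : V m) (ρ : Ray m) : Set (Edge m) := symmDiff (rayEdges ρ) (rootEdges x)

/-- The vertex `x` is an endvertex of the edge `e`. -/
def Incident (e : Edge m) (x : V m) : Prop := parentV e = x ∨ childV e = x

theorem mem_rootEdges_some {f e : Edge m} :
    f ∈ rootEdges (some e) ↔ f.1 = e.1 ∧ f.2 <+: e.2 := Iff.rfl

theorem rootEdges_none : rootEdges (none : V m) = ∅ := rfl

theorem parentV_nil (i : Fin (m + 1)) : parentV (i, ([] : List (Fin m))) = none := rfl

theorem parentV_concat (i : Fin (m + 1)) (l : List (Fin m)) (a : Fin m) :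
    parentV (i, l ++ [a]) = some (i, l) := by
  simp [parentV]

theorem mem_rootEdges_childV {e f : Edge m} :
    f ∈ rootEdges (childV e) ↔ f = e ∨ f ∈ rootEdges (parentV e) := by
  obtain ⟨i, l⟩ := e
  obtain ⟨j, k⟩ := f
  induction l using List.reverseRecOn with
  | nil => simp [childV, parentV_nil, rootEdges_none, mem_rootEdges_some, Prod.ext_iff]
  | append_singleton l a _ =>
    rw [parentV_concat, childV, mem_rootEdges_some, mem_rootEdges_some, List.prefix_concat_iff,
      Prod.ext_iff]
    tauto

theorem notMem_rootEdges_parentV (e : Edge m) : e ∉ rootEdges (parentV e) := by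
  obtain ⟨i, l⟩ := e
  induction l using List.reverseRecOn with
  | nil => simp [parentV_nil, rootEdges_none]
  | append_singleton l a _ =>
    rw [parentV_concat, mem_rootEdges_some]
    intro h
    simpa using h.2.length_le

theorem mem_rootEdges_childV_self (e : Edge m) : e ∈ rootEdges (childV e) :=
  mem_rootEdges_childV.2 (Or.inl rfl)

theorem rootEdges_trans {f g : Edge m} {x : V m} (hf : f ∈ rootEdges (some g))
    (hg : g ∈ rootEdges x) : f ∈ rootEdges x := by
  cases x with
  | none => exact hg.elim
  | some e => exact ⟨hf.1.trans hg.1, hf.2.trans hg.2⟩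

theorem mem_rootEdges_some_of_length_le {f g : Edge m} {x : V m} (hf : f ∈ rootEdges x)
    (hg : g ∈ rootEdges x) (h : f.2.length ≤ g.2.length) : f ∈ rootEdges (some g) := by
  cases x with
  | none => exact hg.elim
  | some e =>
    exact ⟨hf.1.trans hg.1.symm, List.prefix_of_prefix_length_le hf.2 hg.2 h⟩

theorem vertex_induction {P : V m → Prop} (h0 : P none)
    (hs : ∀ e : Edge m, P (parentV e) → P (some e)) (x : V m) : P x := by
  cases x with
  | none => exact h0
  | some e =>
    obtain ⟨i, l⟩ := e
    induction l using List.reverseRecOn with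
    | nil => exact hs _ h0
    | append_singleton l a ih => exact hs _ (by rwa [parentV_concat])

theorem finite_rootEdges (x : V m) : (rootEdges x).Finite := by
  induction x using vertex_induction with
  | h0 => exact Set.finite_empty
  | hs e ih =>
    refine (ih.insert e).subset fun f hf => ?_
    exact mem_rootEdges_childV.1 hf

/-! ### Rays -/

theorem length_rayEdge (ρ : Ray m) (n : ℕ) : (rayEdge ρ n).2.length = n := by
  simp [rayEdge]

theorem rayEdge_injective (ρ : Ray m) : Function.Injective (rayEdge ρ) := fun a b h => by
  rw [← length_rayEdge ρ a, h, length_rayEdge]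

theorem rayEdge_succ (ρ : Ray m) (n : ℕ) :
    rayEdge ρ (n + 1) = (ρ.1, (rayEdge ρ n).2 ++ [ρ.2 n]) :=
  Prod.ext rfl (by simp only [rayEdge]; exact List.ofFn_succ_last)

theorem childV_rayEdge (ρ : Ray m) (n : ℕ) : childV (rayEdge ρ n) = rayVtx ρ (n + 1) := rfl

theorem parentV_rayEdge (ρ : Ray m) (n : ℕ) : parentV (rayEdge ρ n) = rayVtx ρ n := by
  cases n with
  | zero => simp [rayEdge, parentV, rayVtx]
  | succ n => rw [rayEdge_succ, parentV_concat]; rfl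

theorem mem_rootEdges_rayVtx {ρ : Ray m} {n : ℕ} {f : Edge m} :
    f ∈ rootEdges (rayVtx ρ n) ↔ ∃ k < n, f = rayEdge ρ k := by
  induction n with
  | zero => simp [rayVtx, rootEdges_none]
  | succ n ih =>
    rw [← childV_rayEdge, mem_rootEdges_childV, parentV_rayEdge, ih]
    constructor
    · rintro (rfl | ⟨k, hk, rfl⟩)
      · exact ⟨n, by omega, rfl⟩
      · exact ⟨k, by omega, rfl⟩
    · rintro ⟨k, hk, rfl⟩
      rcases Nat.lt_succ_iff_lt_or_eq.1 hk with h | rfl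
      · exact Or.inr ⟨k, h, rfl⟩
      · exact Or.inl rfl

theorem rayVtx_injective (ρ : Ray m) : Function.Injective (rayVtx ρ) := by
  intro a b h
  cases a <;> cases b <;> simp only [rayVtx, Option.some.injEq, reduceCtorEq] at h
  · rfl
  · rw [rayEdge_injective ρ h]

theorem mem_rayEdges_iff {ρ : Ray m} {f : Edge m} :
    f ∈ rayEdges ρ ↔ f.1 = ρ.1 ∧ ∀ k : Fin f.2.length, f.2[k] = ρ.2 k := by
  obtain ⟨i, l⟩ := f
  constructor
  · rintro ⟨n, h⟩
    simp only [rayEdge, Prod.mk.injEq] at h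
    obtain ⟨rfl, rfl⟩ := h
    simp
  · rintro ⟨h, h'⟩
    refine ⟨l.length, Prod.ext h.symm ?_⟩
    refine List.ext_getElem (by simp [rayEdge]) fun k h₁ h₂ => ?_
    simpa [rayEdge] using (h' ⟨k, h₂⟩).symm

theorem eq_rayEdge_length {ρ : Ray m} {f : Edge m} (hf : f ∈ rayEdges ρ) :
    f = rayEdge ρ f.2.length := by
  obtain ⟨n, rfl⟩ := hf
  rw [length_rayEdge]

theorem mem_rayEdges_of_mem_rootEdges {ρ : Ray m} {n : ℕ} {f : Edge m}
    (hf : f ∈ rootEdges (some (rayEdge ρ n))) : f ∈ rayEdges ρ := by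
  obtain ⟨k, -, rfl⟩ := mem_rootEdges_rayVtx (n := n + 1) |>.1 hf
  exact ⟨k, rfl⟩

theorem rayEdge_congr_of_le {ρ σ : Ray m} {n k : ℕ} (h : rayEdge ρ n = rayEdge σ n)
    (hk : k ≤ n) : rayEdge ρ k = rayEdge σ k := by
  have : rayEdge ρ k ∈ rootEdges (rayVtx ρ (n + 1)) :=
    mem_rootEdges_rayVtx.2 ⟨k, by omega, rfl⟩
  rw [rayVtx, h] at this
  have := eq_rayEdge_length (mem_rayEdges_of_mem_rootEdges this)
  rwa [length_rayEdge] at this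

theorem ray_ext {ρ σ : Ray m} (h : ∀ n, rayEdge ρ n = rayEdge σ n) : ρ = σ := by
  refine Prod.ext (congrArg (fun e : Edge m => e.1) (h 0)) (funext fun n => ?_)
  have := h (n + 1)
  rw [rayEdge_succ, rayEdge_succ, h n] at this
  simpa using congrArg Prod.snd this

theorem isClopen_mem_rayEdges (f : Edge m) : IsClopen {ρ : Ray m | f ∈ rayEdges ρ} := by
  simp only [mem_rayEdges_iff, Set.ofPred_and, Set.ofPred_forall]
  refine IsClopen.inter ?_ (isClopen_iInter_of_finite fun k => ?_)
  · exact (isClopen_discrete {i | f.1 = i}).preimage continuous_fst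
  · exact (isClopen_discrete {i | f.2[k] = i}).preimage
      ((continuous_apply (k : ℕ)).comp continuous_snd)

theorem isClopen_mem_pathEdges (x : V m) (f : Edge m) :
    IsClopen {ρ : Ray m | f ∈ pathEdges x ρ} := by
  by_cases hf : f ∈ rootEdges x
  · simpa [pathEdges, Set.mem_symmDiff, hf, Set.compl_def] using (isClopen_mem_rayEdges f).compl
  · simpa [pathEdges, Set.mem_symmDiff, hf] using isClopen_mem_rayEdges f

theorem mem_pathEdges_rayVtx {ρ : Ray m} {n : ℕ} {f : Edge m} :
    f ∈ pathEdges (rayVtx ρ n) ρ ↔ ∃ k ≥ n, f = rayEdge ρ k := by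
  simp only [pathEdges, Set.mem_symmDiff, mem_rootEdges_rayVtx]
  constructor
  · rintro (⟨⟨k, rfl⟩, h⟩ | ⟨⟨k, -, rfl⟩, h⟩)
    · exact ⟨k, not_lt.1 fun hk => h ⟨k, hk, rfl⟩, rfl⟩
    · exact (h ⟨k, rfl⟩).elim
  · rintro ⟨k, hk, rfl⟩
    refine Or.inl ⟨⟨k, rfl⟩, ?_⟩
    rintro ⟨j, hj, h⟩
    have := rayEdge_injective ρ h
    omega

/-! ### Infinite paths -/

theorem EndsAt.rootEdges_symmDiff {e : Edge m} {u v : V m} (h : EndsAt e u v) :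
    rootEdges v = symmDiff {e} (rootEdges u) := by
  ext f
  have h₁ := notMem_rootEdges_parentV e
  have h₂ := mem_rootEdges_childV (e := e) (f := f)
  rw [Set.mem_symmDiff, Set.mem_singleton_iff]
  rcases h with ⟨rfl, rfl⟩ | ⟨rfl, rfl⟩ <;> by_cases hf : f = e
  · subst hf; tauto
  · tauto
  · subst hf; tauto
  · tauto

theorem EndsAt.incident_iff {e : Edge m} {u v x : V m} (h : EndsAt e u v) :
    Incident e x ↔ u = x ∨ v = x := by
  rcases h with ⟨rfl, rfl⟩ | ⟨rfl, rfl⟩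
  · exact Iff.rfl
  · exact or_comm

theorem EndsAt.edge_unique {e f : Edge m} {u v : V m} (he : EndsAt e u v) (hf : EndsAt f u v) :
    e = f := by
  have := he.rootEdges_symmDiff.symm.trans hf.rootEdges_symmDiff
  exact Set.singleton_injective (symmDiff_left_injective _ this)

namespace IPath

variable {x : V m} (π : IPath m x)

theorem exists_vtx_eq_iff {y : V m} : (∃ n, π.vtx n = y) ↔ ∃ e ∈ π.edges, Incident e y := by
  constructor
  · rintro ⟨n, rfl⟩
    obtain ⟨e, he⟩ := π.adj n
    exact ⟨e, ⟨n, he⟩, he.incident_iff.2 (Or.inl rfl)⟩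
  · rintro ⟨e, ⟨n, he⟩, hy⟩
    rcases he.incident_iff.1 hy with h | h
    exacts [⟨n, h⟩, ⟨n + 1, h⟩]

theorem index_unique {e : Edge m} {a b : ℕ} (ha : EndsAt e (π.vtx a) (π.vtx (a + 1)))
    (hb : EndsAt e (π.vtx b) (π.vtx (b + 1))) : a = b := by
  have h₁ := hb.incident_iff.1 (ha.incident_iff.2 (Or.inl rfl))
  have h₂ := hb.incident_iff.1 (ha.incident_iff.2 (Or.inr rfl))
  simp only [π.inj.eq_iff] at h₁ h₂
  omega

theorem mem_rootEdges_vtx (n : ℕ) (f : Edge m) :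
    f ∈ rootEdges (π.vtx n) ↔
      f ∈ symmDiff {g | ∃ k < n, EndsAt g (π.vtx k) (π.vtx (k + 1))} (rootEdges x) := by
  induction n with
  | zero => simp [π.start, Set.mem_symmDiff]
  | succ n ih =>
    obtain ⟨e, he⟩ := π.adj n
    rw [he.rootEdges_symmDiff, Set.mem_symmDiff, ih, Set.mem_symmDiff, Set.mem_symmDiff]
    simp only [Set.mem_singleton_iff, Set.mem_ofPred_eq]
    have key : (∃ k < n + 1, EndsAt f (π.vtx k) (π.vtx (k + 1))) ↔
        f = e ∨ ∃ k < n, EndsAt f (π.vtx k) (π.vtx (k + 1)) := by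
      constructor
      · rintro ⟨k, hk, h⟩
        rcases Nat.lt_succ_iff_lt_or_eq.1 hk with h' | rfl
        · exact Or.inr ⟨k, h', h⟩
        · exact Or.inl (h.edge_unique he)
      · rintro (rfl | ⟨k, hk, h⟩)
        exacts [⟨n, by omega, he⟩, ⟨k, by omega, h⟩]
    have hdisj : f = e → ¬ ∃ k < n, EndsAt f (π.vtx k) (π.vtx (k + 1)) := by
      rintro rfl ⟨k, hk, h⟩
      have := π.index_unique h he
      omega
    rw [key]
    by_cases hfe : f = e
    · simp [hfe, hfe ▸ hdisj hfe]
    · simp [hfe]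

theorem eventually_mem_rootEdges_vtx (f : Edge m) :
    ∀ᶠ n in Filter.atTop, (f ∈ rootEdges (π.vtx n) ↔ f ∈ symmDiff π.edges (rootEdges x)) := by
  have : ∀ᶠ n in Filter.atTop,
      ((∃ k < n, EndsAt f (π.vtx k) (π.vtx (k + 1))) ↔ f ∈ π.edges) := by
    by_cases hf : f ∈ π.edges
    · obtain ⟨k, hk⟩ := id hf
      filter_upwards [Filter.eventually_gt_atTop k] with n hn
      exact ⟨fun _ => hf, fun _ => ⟨k, hn, hk⟩⟩
    · exact Filter.Eventually.of_forall fun n =>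
        ⟨fun ⟨k, _, hk⟩ => (hf ⟨k, hk⟩).elim, fun h => (hf h).elim⟩
  filter_upwards [this] with n hn
  rw [mem_rootEdges_vtx, Set.mem_symmDiff, Set.mem_symmDiff, Set.mem_ofPred_eq, hn]

theorem edges_eq_pathEdges {ρ : Ray m} (h : Assoc π ρ) : π.edges = pathEdges x ρ := by
  set D := symmDiff π.edges (rootEdges x) with hD
  have hfin : (rayEdges ρ \ D).Finite := by
    refine (h.union (finite_rootEdges x)).subset fun f hf => ?_
    simp only [hD, Set.mem_sdiff, Set.mem_symmDiff, Set.mem_union] at hf ⊢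
    tauto
  have hcof : ∀ N, ∃ n ≥ N, rayEdge ρ n ∈ D := by
    intro N
    by_contra! hN
    have hinj : Function.Injective fun n => rayEdge ρ (N + n) := fun a b hab => by
      have := rayEdge_injective ρ hab
      omega
    exact Set.infinite_of_injective_forall_mem hinj
      (fun n => (⟨⟨_, rfl⟩, hN _ (by omega)⟩ : rayEdge ρ (N + n) ∈ rayEdges ρ \ D)) hfin
  have hDray : D = rayEdges ρ := by
    ext f
    obtain ⟨n, hn, hnD⟩ := hcof f.2.length
    obtain ⟨k, hkf, hkn⟩ :=
      ((π.eventually_mem_rootEdges_vtx f).and (π.eventually_mem_rootEdges_vtx _)).exists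
    have hkn := hkn.2 hnD
    constructor
    · intro hf
      exact mem_rayEdges_of_mem_rootEdges
        (mem_rootEdges_some_of_length_le (hkf.2 hf) hkn (by rwa [length_rayEdge]))
    · intro hf
      refine hkf.1 (rootEdges_trans ?_ hkn)
      exact (mem_rootEdges_rayVtx (n := n + 1)).2
        ⟨f.2.length, by omega, eq_rayEdge_length hf⟩
  rw [pathEdges, ← hDray, hD, symmDiff_symmDiff_cancel_right]

/-- The infinite path following a ray from its `k`-th vertex on. -/
def ofRay (ρ : Ray m) (k : ℕ) : IPath m (rayVtx ρ k) where
  vtx n := rayVtx ρ (k + n)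
  start := rfl
  inj a b h := by
    have := rayVtx_injective ρ h
    omega
  adj n := ⟨rayEdge ρ (k + n), Or.inl ⟨parentV_rayEdge ρ _, rfl⟩⟩

theorem assoc_ofRay (ρ : Ray m) (k : ℕ) : Assoc (ofRay ρ k) ρ := by
  have hmem : ∀ e, e ∈ (ofRay ρ k).edges ↔ ∃ n, e = rayEdge ρ (k + n) := fun e =>
    ⟨fun ⟨n, hn⟩ => ⟨n, hn.edge_unique (Or.inl ⟨parentV_rayEdge ρ _, rfl⟩)⟩,
      fun ⟨n, hn⟩ => ⟨n, hn ▸ Or.inl ⟨parentV_rayEdge ρ _, rfl⟩⟩⟩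
  refine (finite_rootEdges (rayVtx ρ k)).subset ?_
  rintro e (⟨he, he'⟩ | ⟨⟨n, rfl⟩, he'⟩)
  · obtain ⟨n, rfl⟩ := (hmem e).1 he
    exact (he' ⟨_, rfl⟩).elim
  · refine mem_rootEdges_rayVtx.2 ⟨n, not_le.1 fun hkn => he' ((hmem _).2 ⟨n - k, ?_⟩), rfl⟩
    rw [Nat.add_sub_cancel' hkn]

/-- Prepend the lower endvertex of an edge to a path from its upper endvertex. -/
def cons {e : Edge m} (π : IPath m (parentV e)) (h : ∀ n, π.vtx n ≠ some e) :
    IPath m (some e) where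
  vtx n := n.casesOn (some e) π.vtx
  start := rfl
  inj a b hab := by
    cases a <;> cases b
    · rfl
    · exact (h _ hab.symm).elim
    · exact (h _ hab).elim
    · rw [π.inj hab]
  adj n := by
    cases n with
    | zero => exact ⟨e, Or.inr ⟨π.start.symm, rfl⟩⟩
    | succ n => exact π.adj n

theorem edges_cons {e : Edge m} (π : IPath m (parentV e)) (h : ∀ n, π.vtx n ≠ some e) :
    (cons π h).edges = insert e π.edges := by
  ext f
  have he : EndsAt e (some e) (π.vtx 0) := Or.inr ⟨π.start.symm, rfl⟩
  constructor
  · rintro ⟨n, hn⟩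
    cases n with
    | zero => exact Or.inl (EndsAt.edge_unique hn he)
    | succ n => exact Or.inr ⟨n, hn⟩
  · rintro (rfl | ⟨n, hn⟩)
    exacts [⟨0, he⟩, ⟨n + 1, hn⟩]

end IPath

theorem exists_assoc (x : V m) (ρ : Ray m) : ∃ π : IPath m x, Assoc π ρ := by
  induction x using vertex_induction with
  | h0 => exact ⟨IPath.ofRay ρ 0, IPath.assoc_ofRay ρ 0⟩
  | hs e ih =>
    by_cases he : e ∈ rayEdges ρ
    · obtain ⟨n, rfl⟩ := he
      exact ⟨IPath.ofRay ρ (n + 1), IPath.assoc_ofRay ρ (n + 1)⟩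
    obtain ⟨π, hπ⟩ := ih
    have hne : ∀ n, π.vtx n ≠ some e := by
      intro n hn
      obtain ⟨g, hg, hge⟩ := π.exists_vtx_eq_iff.1 ⟨n, hn⟩
      rw [π.edges_eq_pathEdges hπ] at hg
      have heg : e ∈ rootEdges (some g) := by
        refine mem_rootEdges_childV.2 ?_
        rcases hge with h | h
        · exact Or.inr (h ▸ mem_rootEdges_childV_self e)
        · exact Or.inl (Option.some.inj h).symm
      rcases hg with ⟨⟨k, rfl⟩, -⟩ | ⟨hg, -⟩
      · exact he (mem_rayEdges_of_mem_rootEdges heg)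
      · exact notMem_rootEdges_parentV e (rootEdges_trans heg hg)
    refine ⟨π.cons hne, (hπ.insert e).subset ?_⟩
    rw [IPath.edges_cons]
    intro f hf
    simp only [Set.mem_insert_iff, Set.mem_union, Set.mem_sdiff] at hf ⊢
    tauto

/-- The paths from the endvertices of `e` ending along `ρu` and `ρv` witness the event `KEdge`,
apart from the condition that these rays be related. -/
structure Witness (e : Edge m) (ω : Config m) (ρu ρv : Ray m) : Prop where
  disjoint : ∀ f ∈ pathEdges (parentV e) ρu, ∀ g ∈ pathEdges (childV e) ρv, ∀ x,
    Incident f x → ¬ Incident g x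
  open_left : ∀ f ∈ pathEdges (parentV e) ρu, ω f = true
  open_right : ∀ f ∈ pathEdges (childV e) ρv, ω f = true
  notMem_left : e ∉ pathEdges (parentV e) ρu
  notMem_right : e ∉ pathEdges (childV e) ρv

theorem mem_ELam_endpoints {e f : Edge m} : f ∈ ELam {parentV e, childV e} ↔ f = e := by
  constructor
  · rintro ⟨hp, hc⟩
    simp only [Set.mem_insert_iff, Set.mem_singleton_iff] at hp hc
    rcases hc with hc | hc
    · have h₁ : f ∈ rootEdges (parentV e) := hc ▸ mem_rootEdges_childV_self f
      have h₂ : f ∈ rootEdges (childV e) := mem_rootEdges_childV.2 (Or.inr h₁)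
      refine (notMem_rootEdges_parentV f ?_).elim
      rcases hp with hp | hp <;> rwa [hp]
    · exact Option.some.inj hc
  · rintro rfl
    exact ⟨by simp, by simp⟩

theorem mem_KEdge_iff {S : Ray m → Ray m → Prop} {e : Edge m} {ω : Config m} :
    ω ∈ KEdge S e ↔ ∃ ρu ρv, S ρu ρv ∧ Witness e ω ρu ρv := by
  constructor
  · rintro ⟨πu, πv, hd, hu, hv, heu, hev, ρu, ρv, hau, hav, hS⟩
    have hu' := πu.edges_eq_pathEdges hau
    have hv' := πv.edges_eq_pathEdges hav
    refine ⟨ρu, ρv, hS, ?_, ?_, ?_, ?_, ?_⟩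
    · rintro f hf g hg x hfx hgx
      obtain ⟨a, rfl⟩ := πu.exists_vtx_eq_iff.2 ⟨f, hu' ▸ hf, hfx⟩
      obtain ⟨b, hb⟩ := πv.exists_vtx_eq_iff.2 ⟨g, hv' ▸ hg, hgx⟩
      exact hd a b hb.symm
    · exact hu' ▸ hu
    · exact hv' ▸ hv
    · exact fun h => heu e (hu' ▸ h) (mem_ELam_endpoints.2 rfl)
    · exact fun h => hev e (hv' ▸ h) (mem_ELam_endpoints.2 rfl)
  · rintro ⟨ρu, ρv, hS, hw⟩
    obtain ⟨πu, hau⟩ := exists_assoc (parentV e) ρu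
    obtain ⟨πv, hav⟩ := exists_assoc (childV e) ρv
    have hu' := πu.edges_eq_pathEdges hau
    have hv' := πv.edges_eq_pathEdges hav
    refine ⟨πu, πv, fun a b hab => ?_, ?_, ?_, ?_, ?_, ρu, ρv, hau, hav, hS⟩
    · obtain ⟨f, hf, hfx⟩ := πu.exists_vtx_eq_iff.1 ⟨a, rfl⟩
      obtain ⟨g, hg, hgx⟩ := πv.exists_vtx_eq_iff.1 ⟨b, rfl⟩
      exact hw.disjoint f (hu' ▸ hf) g (hv' ▸ hg) _ hfx (hab ▸ hgx)
    · rw [OpenPath, hu']; exact hw.open_left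
    · rw [OpenPath, hv']; exact hw.open_right
    · rintro f hf h
      rw [mem_ELam_endpoints] at h
      subst h
      exact hw.notMem_left (hu' ▸ hf)
    · rintro f hf h
      rw [mem_ELam_endpoints] at h
      subst h
      exact hw.notMem_right (hv' ▸ hf)

theorem Witness.mono {e : Edge m} {ω ω' : Config m} {ρu ρv : Ray m} (h : Witness e ω ρu ρv)
    (hω : ∀ f, ω f = true → ω' f = true) : Witness e ω' ρu ρv :=
  { h with
    open_left := fun f hf => hω f (h.open_left f hf)
    open_right := fun f hf => hω f (h.open_right f hf) }

theorem isClosed_witness (e : Edge m) (ω : Config m) :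
    IsClosed {p : Ray m × Ray m | Witness e ω p.1 p.2} := by
  have hu : ∀ f, IsClopen {p : Ray m × Ray m | f ∈ pathEdges (parentV e) p.1} := fun f =>
    (isClopen_mem_pathEdges _ f).preimage continuous_fst
  have hv : ∀ f, IsClopen {p : Ray m × Ray m | f ∈ pathEdges (childV e) p.2} := fun f =>
    (isClopen_mem_pathEdges _ f).preimage continuous_snd
  have hset : {p : Ray m × Ray m | Witness e ω p.1 p.2} =
      {p | (∀ f, f ∈ pathEdges (parentV e) p.1 → ∀ g, g ∈ pathEdges (childV e) p.2 → ∀ x,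
        Incident f x → ¬ Incident g x) ∧ (∀ f, f ∈ pathEdges (parentV e) p.1 → ω f = true) ∧
        (∀ f, f ∈ pathEdges (childV e) p.2 → ω f = true) ∧
        (e ∈ pathEdges (parentV e) p.1 → False) ∧ (e ∈ pathEdges (childV e) p.2 → False)} := by
    ext p
    exact ⟨fun ⟨h₁, h₂, h₃, h₄, h₅⟩ => ⟨h₁, h₂, h₃, h₄, h₅⟩,
      fun ⟨h₁, h₂, h₃, h₄, h₅⟩ => ⟨h₁, h₂, h₃, h₄, h₅⟩⟩
  rw [hset]
  simp only [Set.ofPred_and, Set.ofPred_forall]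
  refine .inter ?_ (.inter ?_ (.inter ?_ (.inter ?_ ?_)))
  · exact isClosed_iInter fun f => isClosed_imp (hu f).isOpen <| by
      simp only [Set.ofPred_forall]
      exact isClosed_iInter fun g => isClosed_imp (hv g).isOpen isClosed_const
  · exact isClosed_iInter fun f => isClosed_imp (hu f).isOpen isClosed_const
  · exact isClosed_iInter fun f => isClosed_imp (hv f).isOpen isClosed_const
  · exact isClosed_imp (hu e).isOpen isClosed_const
  · exact isClosed_imp (hv e).isOpen isClosed_const

/-! ### Boxes -/

/-- The distance of a vertex from the root. -/
def depth : V m → ℕ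
  | none => 0
  | some e => e.2.length + 1

theorem depth_rayVtx (ρ : Ray m) (n : ℕ) : depth (rayVtx ρ n) = n := by
  cases n with
  | zero => rfl
  | succ n => simp [rayVtx, depth, length_rayEdge]

theorem depth_le_of_anc {u v : V m} (h : Anc u v) : depth u ≤ depth v := by
  match u, v with
  | none, _ => exact Nat.zero_le _
  | some _, none => exact h.elim
  | some _, some _ => exact Nat.succ_le_succ h.2.length_le

theorem exists_anc_depth_eq {n : ℕ} {v : V m} (h : n ≤ depth v) : ∃ u, Anc u v ∧ depth u = n := by
  match n, v with
  | 0, v => exact ⟨none, trivial, rfl⟩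
  | n + 1, none => simp [depth] at h
  | n + 1, some e =>
    refine ⟨some (e.1, e.2.take n), ⟨rfl, List.take_prefix _ _⟩, ?_⟩
    simp only [depth] at h ⊢
    simp only [List.length_take]
    omega

theorem isBox_ball (n : ℕ) : IsBox {v : V m | depth v ≤ n} := by
  refine ⟨{v | depth v = n}, ⟨?_, fun ρ => ⟨rayVtx ρ n, depth_rayVtx ρ n, n, rfl⟩⟩, ?_⟩
  · rintro ρ _ _ hu hv ⟨a, rfl⟩ ⟨b, rfl⟩
    simp only [Set.mem_ofPred_eq, depth_rayVtx] at hu hv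
    rw [hu, hv]
  · ext v
    simp only [Set.mem_ofPred_eq, Set.mem_union, insC]
    constructor
    · intro h
      rcases h.eq_or_lt with h | h
      · exact Or.inl h
      · exact Or.inr fun u hu => ((depth_le_of_anc hu).trans_lt h).ne
    · rintro (h | h)
      · exact h.le
      · by_contra! hlt
        obtain ⟨u, hu, hn⟩ := exists_anc_depth_eq hlt.le
        exact h u hu hn

theorem depth_parentV_le (e : Edge m) : depth (parentV e) ≤ depth (childV e) := by
  obtain ⟨i, l⟩ := e
  induction l using List.reverseRecOn with
  | nil => exact Nat.zero_le _
  | append_singleton l a _ => simp [parentV_concat, childV, depth]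

theorem mem_ELam_ball {n : ℕ} {e : Edge m} :
    e ∈ ELam {v : V m | depth v ≤ n} ↔ depth (childV e) ≤ n :=
  ⟨fun h => h.2, fun h => ⟨(depth_parentV_le e).trans h, h⟩⟩

/-- Beyond some level, a ray and all rays sufficiently close to it have no edge in a given box. -/
theorem IsBox.exists_level {Λ : Set (V m)} (hΛ : IsBox Λ) (ρ : Ray m) :
    ∃ N, ∀ n ≥ N, ∀ σ : Ray m, rayEdge σ N = rayEdge ρ N → rayEdge σ n ∉ ELam Λ := by
  obtain ⟨W, ⟨hW, hW'⟩, rfl⟩ := hΛ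
  obtain ⟨_, hv, N, rfl⟩ := hW' ρ
  refine ⟨N, fun n hn σ hσ h => ?_⟩
  have hN : rayVtx σ N = rayVtx ρ N := by
    rw [← parentV_rayEdge, ← parentV_rayEdge, hσ]
  rw [← hN] at hv
  rcases h.2 with h | h
  · have := @rayVtx_injective m σ (n + 1) N (hW σ _ _ h hv ⟨n + 1, rfl⟩ ⟨N, rfl⟩)
    omega
  · refine h _ ?_ hv
    cases N with
    | zero => trivial
    | succ N => exact (mem_rootEdges_rayVtx (n := n + 1)).2 ⟨N, by omega, rfl⟩

theorem le_patchOne {Λ : Set (V m)} {ω : Config m} (f : Edge m) (h : ω f = true) :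
    patchOne Λ ω f = true := by
  simp [patchOne, h]

theorem patchOne_eq_true_iff {Λ : Set (V m)} {ω : Config m} {f : Edge m} :
    patchOne Λ ω f = true ↔ (f ∈ ELam Λ → ω f = true) := by
  by_cases h : f ∈ ELam Λ <;> simp [patchOne, h]

theorem KEdge_subset_KBar (S : Ray m → Ray m → Prop) (e : Edge m) (Λ : Set (V m)) :
    KEdge S e ⊆ KBar S e Λ := fun ω h => by
  obtain ⟨ρu, ρv, hS, hw⟩ := mem_KEdge_iff.1 h
  exact mem_KEdge_iff.2 ⟨ρu, ρv, hS, hw.mono le_patchOne⟩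

theorem iInter_KBar_subset_KEdge {S : Ray m → Ray m → Prop}
    (hS : IsClosed {x : Ray m × Ray m | S x.1 x.2}) (e : Edge m) :
    (⋂ Λ ∈ {Λ : Set (V m) | IsBox Λ}, KBar S e Λ) ⊆ KEdge S e := by
  intro ω hω
  let C : ℕ → Set (Ray m × Ray m) := fun n =>
    {p | S p.1 p.2} ∩ {p | Witness e (patchOne {v | depth v ≤ n} ω) p.1 p.2}
  have hC : ∀ n, IsClosed (C n) := fun n => hS.inter (isClosed_witness e _)
  obtain ⟨p, hp⟩ := IsCompact.nonempty_iInter_of_sequence_nonempty_isCompact_isClosed C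
    (fun n p hp => ⟨hp.1, hp.2.mono fun f hf => by
      rw [patchOne_eq_true_iff, mem_ELam_ball] at hf ⊢
      exact fun h => hf (by omega)⟩)
    (fun n => by
      obtain ⟨ρu, ρv, h⟩ := mem_KEdge_iff.1 (Set.mem_iInter₂.1 hω _ (isBox_ball n))
      exact ⟨(ρu, ρv), h⟩)
    (hC 0).isCompact hC
  have hp : ∀ n, p ∈ C n := Set.mem_iInter.1 hp
  refine mem_KEdge_iff.2 ⟨p.1, p.2, (hp 0).1, { (hp 0).2 with
    open_left := fun f hf => ?_
    open_right := fun f hf => ?_ }⟩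
  · exact patchOne_eq_true_iff.1 ((hp (depth (childV f))).2.open_left f hf)
      (mem_ELam_ball.2 le_rfl)
  · exact patchOne_eq_true_iff.1 ((hp (depth (childV f))).2.open_right f hf)
      (mem_ELam_ball.2 le_rfl)

/-! ### Rays splitting at a vertex -/

theorem incident_of_mem_pathEdges_rayVtx {ρ : Ray m} {n : ℕ} {f : Edge m} {x : V m}
    (hf : f ∈ pathEdges (rayVtx ρ n) ρ) (hx : Incident f x) : ∃ k ≥ n, x = rayVtx ρ k := by
  obtain ⟨k, hk, rfl⟩ := mem_pathEdges_rayVtx.1 hf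
  rcases hx with rfl | rfl
  · exact ⟨k, hk, parentV_rayEdge ρ k⟩
  · exact ⟨k + 1, by omega, rfl⟩

/-- Two rays which split at the upper endvertex of an edge of the second one witness `KEdge` for
this edge, provided that they are open from there on. -/
theorem witness_of_split {ρ σ : Ray m} {k : ℕ} {e : Edge m} {ω : Config m}
    (he : rayEdge σ k = e) (hk : rayVtx ρ k = parentV e) (hne : rayEdge ρ k ≠ e)
    (hρ : ∀ n ≥ k, ω (rayEdge ρ n) = true) (hσ : ∀ n ≥ k + 1, ω (rayEdge σ n) = true) :
    Witness e ω ρ σ := by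
  have hu : pathEdges (parentV e) ρ = pathEdges (rayVtx ρ k) ρ := by rw [hk]
  have hv : pathEdges (childV e) σ = pathEdges (rayVtx σ (k + 1)) σ := by
    rw [← he, childV_rayEdge]
  constructor
  · rw [hu, hv]
    intro f hf g hg x hfx hgx
    obtain ⟨i, hi, rfl⟩ := incident_of_mem_pathEdges_rayVtx hf hfx
    obtain ⟨j, hj, hij⟩ := incident_of_mem_pathEdges_rayVtx hg hgx
    obtain rfl : i = j := by rw [← depth_rayVtx ρ i, hij, depth_rayVtx]
    obtain ⟨i, rfl⟩ := Nat.exists_eq_add_of_le' (Nat.one_le_of_lt hj)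
    exact hne ((rayEdge_congr_of_le (Option.some.inj hij) (by omega)).trans he)
  · rw [hu]
    intro f hf
    obtain ⟨n, hn, rfl⟩ := mem_pathEdges_rayVtx.1 hf
    exact hρ n hn
  · rw [hv]
    intro f hf
    obtain ⟨n, hn, rfl⟩ := mem_pathEdges_rayVtx.1 hf
    exact hσ n hn
  · rw [hu]
    intro h
    obtain ⟨n, -, rfl⟩ := mem_pathEdges_rayVtx.1 h
    obtain rfl : k = n := by rw [← length_rayEdge σ k, he, length_rayEdge]
    exact hne rfl
  · rw [hv]
    intro h
    obtain ⟨n, hn, rfl⟩ := mem_pathEdges_rayVtx.1 h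
    have := rayEdge_injective σ he
    omega

theorem eq_or_eq_of_rayEdges_subset {ρ σ τ : Ray m}
    (h : rayEdges τ ⊆ rayEdges ρ ∪ rayEdges σ) : τ = ρ ∨ τ = σ := by
  have h' : ∀ n, rayEdge τ n = rayEdge ρ n ∨ rayEdge τ n = rayEdge σ n := fun n => by
    refine (h ⟨n, rfl⟩).imp ?_ ?_ <;>
    · intro hn
      simpa only [length_rayEdge] using eq_rayEdge_length hn
  by_contra! hne
  obtain ⟨a, ha⟩ := not_forall.1 fun H => hne.1 (ray_ext H)
  obtain ⟨b, hb⟩ := not_forall.1 fun H => hne.2 (ray_ext H)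
  rcases h' (max a b) with h | h
  · exact ha (rayEdge_congr_of_le h (le_max_left _ _))
  · exact hb (rayEdge_congr_of_le h (le_max_right _ _))

theorem exists_split {ρ σ : Ray m} (h : ρ ≠ σ) :
    ∃ k, rayEdge ρ k ≠ rayEdge σ k ∧ rayVtx ρ k = rayVtx σ k := by
  have hex : ∃ k, rayEdge ρ k ≠ rayEdge σ k := not_forall.1 fun H => h (ray_ext H)
  classical
  refine ⟨Nat.find hex, Nat.find_spec hex, ?_⟩
  cases hk : Nat.find hex with
  | zero => rfl
  | succ k => exact congrArg some (not_not.1 (Nat.find_min hex (m := k) (by omega)))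

theorem isClosed_of_iInter_KBar_subset {S : Ray m → Ray m → Prop} (hrefl : ∀ ρ, S ρ ρ)
    (h : ∀ e : Edge m, (⋂ Λ ∈ {Λ : Set (V m) | IsBox Λ}, KBar S e Λ) ⊆ KEdge S e) :
    IsClosed {x : Ray m × Ray m | S x.1 x.2} := by
  refine isClosed_of_closure_subset ?_
  rintro ⟨ρ, σ⟩ hcl
  rcases eq_or_ne ρ σ with rfl | hρσ
  · exact hrefl ρ
  obtain ⟨k, hk, hk'⟩ := exists_split hρσ
  set e := rayEdge σ k with he
  have hpar : rayVtx ρ k = parentV e := by rw [hk', parentV_rayEdge]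
  classical
  let ω : Config m := fun f => decide (f ∈ rayEdges ρ ∪ rayEdges σ)
  have hω : ω ∈ KEdge S e := by
    refine h e (Set.mem_iInter₂.2 fun Λ hΛ => ?_)
    obtain ⟨a, ha⟩ := IsBox.exists_level hΛ ρ
    obtain ⟨b, hb⟩ := IsBox.exists_level hΛ σ
    let N := max k (max a b)
    let U : Set (Ray m × Ray m) :=
      {p | rayEdge ρ N ∈ rayEdges p.1} ∩ {p | rayEdge σ N ∈ rayEdges p.2}
    have hU : IsOpen U := ((isClopen_mem_rayEdges _).isOpen.preimage continuous_fst).inter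
      ((isClopen_mem_rayEdges _).isOpen.preimage continuous_snd)
    obtain ⟨⟨ρ', σ'⟩, ⟨hρ', hσ'⟩, hS⟩ := mem_closure_iff.1 hcl U hU ⟨⟨N, rfl⟩, ⟨N, rfl⟩⟩
    have hρ' : rayEdge ρ' N = rayEdge ρ N := by
      simpa only [length_rayEdge] using (eq_rayEdge_length hρ').symm
    have hσ' : rayEdge σ' N = rayEdge σ N := by
      simpa only [length_rayEdge] using (eq_rayEdge_length hσ').symm
    have hρk := rayEdge_congr_of_le hρ' (show k ≤ N by omega)
    have hσk := rayEdge_congr_of_le hσ' (show k ≤ N by omega)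
    refine mem_KEdge_iff.2 ⟨ρ', σ', hS, witness_of_split hσk ?_ (hρk ▸ hk) ?_ ?_⟩
    · rw [← hpar, ← parentV_rayEdge, ← parentV_rayEdge, hρk]
    · intro n _
      refine patchOne_eq_true_iff.2 fun hn => decide_eq_true (Or.inl ⟨n, ?_⟩)
      refine (rayEdge_congr_of_le hρ' (not_lt.1 fun hlt => ?_)).symm
      exact ha n (by omega) ρ' (rayEdge_congr_of_le hρ' (by omega)) hn
    · intro n _
      refine patchOne_eq_true_iff.2 fun hn => decide_eq_true (Or.inr ⟨n, ?_⟩)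
      refine (rayEdge_congr_of_le hσ' (not_lt.1 fun hlt => ?_)).symm
      exact hb n (by omega) σ' (rayEdge_congr_of_le hσ' (by omega)) hn
  obtain ⟨τu, τv, hS, hw⟩ := mem_KEdge_iff.1 hω
  have heρ : e ∉ rayEdges ρ := fun hmem => by
    have := eq_rayEdge_length hmem
    rw [he, length_rayEdge] at this
    exact hk this.symm
  have heσ : e ∈ rayEdges σ := ⟨k, rfl⟩
  have hv_sub : rootEdges (parentV e) ⊆ rayEdges ρ := by
    rw [← hpar]
    intro f hf
    obtain ⟨n, -, rfl⟩ := mem_rootEdges_rayVtx.1 hf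
    exact ⟨n, rfl⟩
  have hu : τu = ρ ∨ τu = σ := by
    refine eq_or_eq_of_rayEdges_subset fun f hf => ?_
    by_cases hfr : f ∈ rootEdges (parentV e)
    · exact Or.inl (hv_sub hfr)
    · exact of_decide_eq_true (hw.open_left f (Or.inl ⟨hf, hfr⟩))
  have hv : τv = ρ ∨ τv = σ := by
    refine eq_or_eq_of_rayEdges_subset fun f hf => ?_
    by_cases hfr : f ∈ rootEdges (childV e)
    · rcases mem_rootEdges_childV.1 hfr with rfl | hfr
      exacts [Or.inr heσ, Or.inl (hv_sub hfr)]
    · exact of_decide_eq_true (hw.open_right f (Or.inl ⟨hf, hfr⟩))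
  have hu : τu = ρ := hu.resolve_right fun hτ =>
    hw.notMem_left (Or.inl ⟨hτ ▸ heσ, notMem_rootEdges_parentV e⟩)
  have hv : τv = σ := hv.resolve_left fun hτ =>
    hw.notMem_right (Or.inr ⟨mem_rootEdges_childV_self e, hτ ▸ heρ⟩)
  rwa [hu, hv] at hS

/-- The events `K̄^S_{e,Λ}` decrease to `K^S_e` as `Λ ↑ V`, i.e.
`K^S_e = ⋂_Λ K̄^S_{e,Λ}` with the intersection over all boxes `Λ`, for every edge `e`,
if and only if `S` is a closed subset of `R × R`. -/
theorem kbar_inter_iff_closed (m : ℕ) (hm : 2 ≤ m) (S : Ray m → Ray m → Prop)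
    (hrefl : ∀ ρ, S ρ ρ) (hsymm : ∀ ρ₁ ρ₂, S ρ₁ ρ₂ → S ρ₂ ρ₁) :
    (∀ e : Edge m, (⋂ Λ ∈ {Λ : Set (V m) | IsBox Λ}, KBar S e Λ) = KEdge S e) ↔
      IsClosed {x : Ray m × Ray m | S x.1 x.2} := by
  constructor
  · exact fun h => isClosed_of_iInter_KBar_subset hrefl fun e => (h e).subset
  · exact fun hS e => (iInter_KBar_subset_KEdge hS e).antisymm
      (Set.subset_iInter₂ fun Λ _ => KEdge_subset_KBar S e Λ)

end RCTree
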